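/- The pair (cpk, cdes) is cyclic shuffle-compatible: if π, σ are disjoint permutations, π′, σ′ are disjoint permutations, |π| = |π′|, |σ| = |σ′|, (cpk[π], cdes[π]) = (cpk[π′], cdes[π′]), and (cpk[σ], cdes[σ]) = (cpk[σ′], cdes[σ′]), then the multiset {{(cpk[τ], cdes[τ]) : [τ] ∈ [π] ⧢ [σ]}}, where [τ] ranges over the set of cyclic shuffles of [π] and [σ] (each cyclic shuffle counted once), equals the multiset {{(cpk[τ], cdes[τ]) : [τ] ∈ [π′] ⧢ [σ′]}}. -/

import Mathlib

/-- A permutation: a list of distinct positive integers. -/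
def IsPerm (π : List ℕ) : Prop := π.Nodup ∧ ∀ x ∈ π, 0 < x

/-- The descent set `Des π = {i ∈ {1,…,n−1} : π_i > π_{i+1}}` (1-based indexing). -/
def Des (π : List ℕ) : Finset ℕ :=
  (Finset.Icc 1 (π.length - 1)).filter fun i => π.getD i 0 < π.getD (i - 1) 0

/-- The descent number. -/
def des (π : List ℕ) : ℕ := (Des π).card

/-- The major index. -/
def maj (π : List ℕ) : ℕ := ∑ i ∈ Des π, i

/-- The cyclic descent set `cDes π = {i ∈ {1,…,n} : π_i > π_{i+1}}`, indices mod `n`. -/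
def cDes (π : List ℕ) : Finset ℕ :=
  (Finset.Icc 1 π.length).filter fun i => π.getD (i % π.length) 0 < π.getD (i - 1) 0

/-- The cyclic descent number. -/
def cdes (π : List ℕ) : ℕ := (cDes π).card

/-- The cyclic major index. -/
def cmaj (π : List ℕ) : ℕ := ∑ i ∈ cDes π, i

/-- The peak set `Pk π = {i ∈ {2,…,n−1} : π_{i−1} < π_i > π_{i+1}}` (1-based indexing). -/
def Pk (π : List ℕ) : Finset ℕ :=
  (Finset.Icc 2 (π.length - 1)).filter fun i =>
    π.getD (i - 2) 0 < π.getD (i - 1) 0 ∧ π.getD i 0 < π.getD (i - 1) 0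

/-- The peak number. -/
def pk (π : List ℕ) : ℕ := (Pk π).card

/-- The cyclic peak set `cPk π = {i ∈ {1,…,n} : π_{i−1} < π_i > π_{i+1}}`, indices mod `n`. -/
def cPk (π : List ℕ) : Finset ℕ :=
  (Finset.Icc 1 π.length).filter fun i =>
    π.getD ((i + π.length - 2) % π.length) 0 < π.getD (i - 1) 0 ∧
      π.getD (i % π.length) 0 < π.getD (i - 1) 0

/-- The cyclic peak number. -/
def cpk (π : List ℕ) : ℕ := (cPk π).card

/-- The cyclic valley set `cVal π = {i ∈ {1,…,n} : π_{i−1} > π_i < π_{i+1}}`, indices mod `n`. -/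
def cVal (π : List ℕ) : Finset ℕ :=
  (Finset.Icc 1 π.length).filter fun i =>
    π.getD (i - 1) 0 < π.getD ((i + π.length - 2) % π.length) 0 ∧
      π.getD (i - 1) 0 < π.getD (i % π.length) 0

/-- The cyclic valley number. -/
def cval (π : List ℕ) : ℕ := (cVal π).card

/-- The distribution of a linear statistic `st` over the `n` rotations of `π`,
i.e. the multiset-valued cyclic statistic induced by `st`, evaluated at `[π]`. -/
def cycStat {A : Type*} (st : List ℕ → A) (π : List ℕ) : Multiset A :=
  (Multiset.range π.length).map fun i => st (π.rotate i)

/-- `τ` is a (linear) shuffle of `π` and `σ`. -/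
def IsShuffle (π σ τ : List ℕ) : Prop :=
  π.Sublist τ ∧ σ.Sublist τ ∧ τ.length = π.length + σ.length

/-- `[τ]` is a cyclic shuffle of `[π]` and `[σ]`: some rotation of `τ` is a shuffle
of some rotation of `π` and some rotation of `σ`. -/
def IsCyclicShuffle (π σ τ : List ℕ) : Prop :=
  ∃ i j k, IsShuffle (π.rotate i) (σ.rotate j) (τ.rotate k)

/-- The set of cyclic shuffles of `[π]` and `[σ]` (as elements of `Cycle ℕ`, so that each
cyclic shuffle is counted once) on which the statistic `cst` takes the value `v`. -/
def cycShuffleFiber {A : Type*} (cst : List ℕ → A) (π σ : List ℕ) (v : A) : Set (Cycle ℕ) :=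
  {c : Cycle ℕ | ∃ τ : List ℕ, (↑τ : Cycle ℕ) = c ∧ IsCyclicShuffle π σ τ ∧ cst τ = v}

/-- A (rotation-invariant) statistic `cst` is cyclic shuffle-compatible if the distribution
of `cst` over the set of cyclic shuffles of `[π]` and `[σ]` (each cyclic shuffle counted
once) depends only on `cst π`, `cst σ`, `|π|` and `|σ|`. -/
def CyclicShuffleCompatible {A : Type*} (cst : List ℕ → A) : Prop :=
  ∀ π σ π' σ' : List ℕ, IsPerm π → IsPerm σ → IsPerm π' → IsPerm σ' →
    π.Disjoint σ → π'.Disjoint σ' →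
    π.length = π'.length → σ.length = σ'.length →
    cst π = cst π' → cst σ = cst σ' →
    ∀ v : A, (cycShuffleFiber cst π σ v).ncard = (cycShuffleFiber cst π' σ' v).ncard

open Polynomial

section Reading

/-- The sorting key of a letter under a labelling by signed blocks: blocks are read in increasing
order, within a block negative letters come first, in decreasing order, and positive letters
follow in increasing order. -/
def blockKey {M : ℕ} (f : ℕ → ZMod M × Bool) (x : ℕ) : ℕ ×ₗ Bool ×ₗ ℤ :=
  toLex ((f x).1.val, toLex ((f x).2, if (f x).2 then (x : ℤ) else -x))

theorem blockKey_injective {M : ℕ} (f : ℕ → ZMod M × Bool) : Function.Injective (blockKey f) := by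
  intro x y h
  have h1 := congrArg (fun z => (ofLex (ofLex z).2).1) h
  have h2 := congrArg (fun z => (ofLex (ofLex z).2).2) h
  simp only [blockKey, ofLex_toLex] at h1 h2
  rw [h1] at h2
  split_ifs at h2 <;> omega

instance blockKey_total {M : ℕ} (f : ℕ → ZMod M × Bool) :
    Std.Total fun x y => blockKey f x ≤ blockKey f y := ⟨fun _ _ => le_total _ _⟩

instance blockKey_trans {M : ℕ} (f : ℕ → ZMod M × Bool) :
    IsTrans ℕ fun x y => blockKey f x ≤ blockKey f y := ⟨fun _ _ _ => le_trans⟩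

/-- The word obtained by reading the letters of `A` block by block. -/
noncomputable def readingWord {M : ℕ} (f : ℕ → ZMod M × Bool) (A : Finset ℕ) : List ℕ :=
  A.toList.insertionSort fun x y => blockKey f x ≤ blockKey f y

variable {M : ℕ} (f : ℕ → ZMod M × Bool)

theorem readingWord_perm (A : Finset ℕ) : (readingWord f A).Perm A.toList :=
  List.perm_insertionSort _ _

theorem readingWord_nodup (A : Finset ℕ) : (readingWord f A).Nodup :=
  (readingWord_perm f A).nodup_iff.2 A.nodup_toList

theorem readingWord_pairwise (A : Finset ℕ) :
    (readingWord f A).Pairwise fun x y => blockKey f x < blockKey f y := by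
  have h := List.pairwise_insertionSort (fun x y => blockKey f x ≤ blockKey f y) A.toList
  refine (h.and (readingWord_nodup f A)).imp ?_
  rintro a b ⟨h1, h2⟩
  exact lt_of_le_of_ne h1 fun h => h2 (blockKey_injective f h)

theorem readingWord_eq {A : Finset ℕ} {l : List ℕ} (hl : l.Perm A.toList)
    (hp : l.Pairwise fun x y => blockKey f x < blockKey f y) : readingWord f A = l :=
  List.Perm.eq_of_pairwise (fun _ _ _ _ h1 h2 => absurd h2 h1.not_gt) (readingWord_pairwise f A) hp
    ((readingWord_perm f A).trans hl.symm)

theorem readingWord_congr {g : ℕ → ZMod M × Bool} {A : Finset ℕ} (h : ∀ x ∈ A, f x = g x) :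
    readingWord f A = readingWord g A := by
  refine readingWord_eq f (readingWord_perm g A) ?_
  refine (readingWord_pairwise g A).imp_of_mem ?_
  intro a b ha hb hab
  have ha' : a ∈ A := by simpa using (readingWord_perm g A).mem_iff.1 ha
  have hb' : b ∈ A := by simpa using (readingWord_perm g A).mem_iff.1 hb
  simpa only [blockKey, h a ha', h b hb'] using hab

theorem filter_readingWord {A B : Finset ℕ} (h : A ⊆ B) :
    (readingWord f B).filter (· ∈ A) = readingWord f A := by
  refine (readingWord_eq f ?_ ((readingWord_pairwise f B).filter _)).symm
  refine (List.perm_ext_iff_of_nodup ((readingWord_nodup f B).filter _) A.nodup_toList).2 ?_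
  intro a
  have : a ∈ readingWord f B ↔ a ∈ B := by simp [(readingWord_perm f B).mem_iff]
  simp only [List.mem_filter, this, Finset.mem_toList, decide_eq_true_eq]
  exact ⟨fun h => h.2, fun h' => ⟨h h', h'⟩⟩

/-- Extension of a labelling of `A` by a default value. -/
def extendLabel {A : Finset ℕ} (g : A → ZMod M × Bool) (x : ℕ) : ZMod M × Bool :=
  if h : x ∈ A then g ⟨x, h⟩ else (0, false)

/-- The weight of a sign: negative letters are marked by `X`. -/
noncomputable def signWeight (b : Bool) : ℤ[X] := if b then 1 else X

/-- The generating polynomial, by number of negative letters, of the labellings of `A` whose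
reading word represents `c`. -/
noncomputable def labelSum (M : ℕ) [NeZero M] (A : Finset ℕ) (c : Cycle ℕ) : ℤ[X] :=
  ∑ g : A → ZMod M × Bool,
    if (readingWord (extendLabel g) A : Cycle ℕ) = c then ∏ a, signWeight (g a).2 else 0

end Reading

section Shuffle

theorem List.isRotated_filter {α : Type*} (p : α → Bool) {l l' : List α} (h : l ~r l') :
    l.filter p ~r l'.filter p := by
  obtain ⟨k, rfl⟩ := h
  rw [List.rotate_eq_drop_append_take_mod, List.filter_append]
  conv_lhs => rw [← List.take_append_drop (k % l.length) l, List.filter_append]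
  exact List.isRotated_append

variable {π σ τ : List ℕ}

theorem filter_mem_of_perm_append (hd : π.Disjoint σ) (h : τ.Perm (π ++ σ)) :
    (τ.filter (· ∈ π.toFinset)).Perm π ∧ (τ.filter (· ∈ σ.toFinset)).Perm σ := by
  have h1 := h.filter (· ∈ π.toFinset)
  have h2 := h.filter (· ∈ σ.toFinset)
  rw [List.filter_append] at h1 h2
  have e1 : π.filter (· ∈ π.toFinset) = π := List.filter_eq_self.2 (by simp)
  have e2 : σ.filter (· ∈ σ.toFinset) = σ := List.filter_eq_self.2 (by simp)
  have e3 : σ.filter (· ∈ π.toFinset) = [] :=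
    List.filter_eq_nil_iff.2 fun a h h' => hd (by simpa using h') h
  have e4 : π.filter (· ∈ σ.toFinset) = [] :=
    List.filter_eq_nil_iff.2 fun a h h' => hd h (by simpa using h')
  rw [e1, e3, List.append_nil] at h1
  rw [e2, e4, List.nil_append] at h2
  exact ⟨h1, h2⟩

theorem isCyclicShuffle_iff (hπ : π.Nodup) (hσ : σ.Nodup) (hd : π.Disjoint σ) :
    IsCyclicShuffle π σ τ ↔ τ.Perm (π ++ σ) ∧ τ.filter (· ∈ π.toFinset) ~r π ∧
      τ.filter (· ∈ σ.toFinset) ~r σ := by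
  constructor
  · rintro ⟨i, j, k, h1, h2, h3⟩
    have hp : τ.Perm (π ++ σ) := by
      refine (List.Perm.symm ?_)
      refine (List.subperm_of_subset (hπ.append hσ hd) ?_).perm_of_length_le ?_
      · intro a ha
        rcases List.mem_append.1 ha with ha | ha
        · exact List.mem_rotate.1 (h1.subset (List.mem_rotate.2 ha))
        · exact List.mem_rotate.1 (h2.subset (List.mem_rotate.2 ha))
      · simpa using h3.le
    obtain ⟨p1, p2⟩ := filter_mem_of_perm_append hd ((List.rotate_perm τ k).trans hp)
    have e1 : π.rotate i = (τ.rotate k).filter (· ∈ π.toFinset) := by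
      refine List.Sublist.eq_of_length ?_ (by simpa using p1.length_eq.symm)
      have := h1.filter (· ∈ π.toFinset)
      rwa [List.filter_eq_self.2 (by simp)] at this
    have e2 : σ.rotate j = (τ.rotate k).filter (· ∈ σ.toFinset) := by
      refine List.Sublist.eq_of_length ?_ (by simpa using p2.length_eq.symm)
      have := h2.filter (· ∈ σ.toFinset)
      rwa [List.filter_eq_self.2 (by simp)] at this
    refine ⟨hp, ?_, ?_⟩
    · refine (List.isRotated_filter _ (List.IsRotated.forall τ k).symm).trans ?_
      rw [← e1]
      exact List.IsRotated.forall _ _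
    · refine (List.isRotated_filter _ (List.IsRotated.forall τ k).symm).trans ?_
      rw [← e2]
      exact List.IsRotated.forall _ _
  · rintro ⟨hp, h1, h2⟩
    obtain ⟨i, hi⟩ := h1.symm
    obtain ⟨j, hj⟩ := h2.symm
    refine ⟨i, j, 0, ?_, ?_, ?_⟩
    · rw [hi, List.rotate_zero]
      exact List.filter_sublist
    · rw [hj, List.rotate_zero]
      exact List.filter_sublist
    · simpa using hp.length_eq

theorem isCyclicShuffle_of_isRotated (hπ : π.Nodup) (hσ : σ.Nodup) (hd : π.Disjoint σ)
    {τ' : List ℕ} (h : τ ~r τ') (hs : IsCyclicShuffle π σ τ) : IsCyclicShuffle π σ τ' := by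
  rw [isCyclicShuffle_iff hπ hσ hd] at hs ⊢
  exact ⟨h.perm.symm.trans hs.1, (List.isRotated_filter _ h.symm).trans hs.2.1,
    (List.isRotated_filter _ h.symm).trans hs.2.2⟩

theorem isCyclicShuffle_readingWord_iff (hπ : π.Nodup) (hσ : σ.Nodup) (hd : π.Disjoint σ) {M : ℕ}
    (f : ℕ → ZMod M × Bool) :
    IsCyclicShuffle π σ (readingWord f (π.toFinset ∪ σ.toFinset)) ↔
      readingWord f π.toFinset ~r π ∧ readingWord f σ.toFinset ~r σ := by
  rw [isCyclicShuffle_iff hπ hσ hd, filter_readingWord f Finset.subset_union_left,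
    filter_readingWord f Finset.subset_union_right, and_iff_right]
  refine (readingWord_perm f _).trans ?_
  refine (List.perm_ext_iff_of_nodup (Finset.nodup_toList _) (hπ.append hσ hd)).2 ?_
  simp

/-- The finite set of cyclic shuffles. -/
noncomputable def cycShuffles (π σ : List ℕ) : Finset (Cycle ℕ) := by
  classical
  exact ((π ++ σ).permutations.toFinset.image ((↑) : List ℕ → Cycle ℕ)).filter
    fun c => ∃ τ : List ℕ, (τ : Cycle ℕ) = c ∧ IsCyclicShuffle π σ τ

theorem coe_mem_cycShuffles (hπ : π.Nodup) (hσ : σ.Nodup) (hd : π.Disjoint σ) :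
    (τ : Cycle ℕ) ∈ cycShuffles π σ ↔ IsCyclicShuffle π σ τ := by
  simp only [cycShuffles, Finset.mem_filter, List.mem_toFinset, Finset.mem_image,
    List.mem_permutations]
  constructor
  · rintro ⟨-, τ', h, hs⟩
    exact isCyclicShuffle_of_isRotated hπ hσ hd (Cycle.coe_eq_coe.1 h) hs
  · intro h
    exact ⟨⟨τ, ((isCyclicShuffle_iff hπ hσ hd).1 h).1, rfl⟩, τ, rfl, h⟩

/-- Labelled cyclic shuffles are pairs of labelled cyclic permutations. -/
theorem sum_labelSum_cycShuffles (hπ : π.Nodup) (hσ : σ.Nodup) (hd : π.Disjoint σ) (M : ℕ)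
    [NeZero M] :
    ∑ c ∈ cycShuffles π σ, labelSum M (π.toFinset ∪ σ.toFinset) c =
      labelSum M π.toFinset π * labelSum M σ.toFinset σ := by
  have hAB : Disjoint π.toFinset σ.toFinset := by
    rw [Finset.disjoint_left]
    intro a h1 h2
    exact hd (List.mem_toFinset.1 h1) (List.mem_toFinset.1 h2)
  set A := π.toFinset with hA
  set B := σ.toFinset with hB
  simp only [labelSum]
  rw [Finset.sum_comm, Finset.sum_mul_sum, ← Fintype.sum_prod_type']
  refine (Fintype.sum_equiv (Equiv.piFinsetUnion (fun _ => ZMod M × Bool) hAB) _ _ ?_).symm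
  rintro ⟨g, k⟩
  set f := Equiv.piFinsetUnion (fun _ => ZMod M × Bool) hAB (g, k) with hf
  have fl : ∀ (x : ℕ) (hx : x ∈ A), f ⟨x, Finset.mem_union_left _ hx⟩ = g ⟨x, hx⟩ :=
    fun x hx => Equiv.piFinsetUnion_left _ hAB _ _
  have fr : ∀ (x : ℕ) (hx : x ∈ B), f ⟨x, Finset.mem_union_right _ hx⟩ = k ⟨x, hx⟩ :=
    fun x hx => Equiv.piFinsetUnion_right _ hAB _ _
  have rl : readingWord (extendLabel f) A = readingWord (extendLabel g) A := by
    refine readingWord_congr _ fun x hx => ?_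
    simp [extendLabel, hx, fl x hx]
  have rr : readingWord (extendLabel f) B = readingWord (extendLabel k) B := by
    refine readingWord_congr _ fun x hx => ?_
    simp [extendLabel, hx, fr x hx]
  have hw : (∏ a, signWeight (f a).2) =
      (∏ a, signWeight (g a).2) * ∏ a, signWeight (k a).2 := by
    have e1 : (∏ a, signWeight (f a).2) =
        ∏ x ∈ A ∪ B, signWeight (extendLabel f x).2 := by
      rw [← Finset.prod_coe_sort (A ∪ B)]
      refine Finset.prod_congr rfl fun a _ => ?_
      have := a.2
      simp only [extendLabel, dif_pos this]
    have e2 : (∏ a, signWeight (g a).2) = ∏ x ∈ A, signWeight (extendLabel f x).2 := by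
      rw [← Finset.prod_coe_sort (A)]
      refine Finset.prod_congr rfl fun a _ => ?_
      simp [extendLabel, fl a a.2]
    have e3 : (∏ a, signWeight (k a).2) = ∏ x ∈ B, signWeight (extendLabel f x).2 := by
      rw [← Finset.prod_coe_sort (B)]
      refine Finset.prod_congr rfl fun a _ => ?_
      simp [extendLabel, fr a a.2]
    rw [e1, e2, e3, Finset.prod_union hAB]
  have hm := isCyclicShuffle_readingWord_iff hπ hσ hd (extendLabel f)
  rw [← coe_mem_cycShuffles hπ hσ hd, ← hA, ← hB, rl, rr, ← Cycle.coe_eq_coe,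
    ← Cycle.coe_eq_coe] at hm
  rw [Finset.sum_ite_eq, hw]
  simp only [hm]
  split_ifs <;> simp_all

end Shuffle

section Winding

theorem exists_pairwise_rotate_ofFn_iff {α : Type*} {R : α → α → Prop} [IsTrans α R] {n : ℕ}
    (x : Fin (n + 1) → α) :
    (∃ r, ((List.ofFn x).rotate r).Pairwise R) ↔
      ∃ r : Fin (n + 1), ∀ j ≠ r, R (x j) (x (j + 1)) := by
  have key : ∀ r : Fin (n + 1), ((List.ofFn x).rotate (r + 1 : Fin (n + 1)).val).Pairwise R ↔
      ∀ j ≠ r, R (x j) (x (j + 1)) := by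
    intro r
    rw [← List.isChain_iff_pairwise, List.isChain_iff_getElem]
    have hget : ∀ (i : ℕ) (hi : i < ((List.ofFn x).rotate (r + 1 : Fin (n + 1)).val).length),
        ((List.ofFn x).rotate (r + 1 : Fin (n + 1)).val)[i] = x (Fin.ofNat (n + 1) i + (r + 1)) := by
      intro i hi
      rw [List.getElem_rotate, List.getElem_ofFn]
      congr 1
      ext
      simp [Fin.val_add]
    simp only [hget, List.length_rotate, List.length_ofFn]
    constructor
    · intro h j hj
      have hlt : (j - (r + 1)).val < n := by
        refine lt_of_le_of_ne (Nat.lt_succ_iff.1 (j - (r + 1)).isLt) fun h' => hj ?_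
        have h2 : j - (r + 1) = Fin.last n := Fin.ext h'
        have h3 : (Fin.last n : Fin (n + 1)) + 1 = 0 := by simp
        rw [← h2] at h3
        have : j - r = 0 := by rw [← h3]; abel
        exact sub_eq_zero.1 this
      have := h (j - (r + 1)).val (by omega)
      have e1 : Fin.ofNat (n + 1) (j - (r + 1)).val = j - (r + 1) := by
        ext; simp
      have e2 : Fin.ofNat (n + 1) ((j - (r + 1)).val + 1) = j - (r + 1) + 1 := by
        ext; simp [Fin.val_add]
      rw [e1, e2] at this
      convert this using 2 <;> abel
    · intro h i hi
      have e2 : Fin.ofNat (n + 1) (i + 1) = Fin.ofNat (n + 1) i + 1 := by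
        ext; simp [Fin.val_add]
      have := h (Fin.ofNat (n + 1) i + (r + 1)) ?_
      · rw [e2]
        convert this using 2
        abel
      · intro h'
        have h0 : Fin.ofNat (n + 1) (i + 1) = 0 := by
          rw [e2]
          have : Fin.ofNat (n + 1) i + 1 = Fin.ofNat (n + 1) i + (r + 1) - r := by abel
          rw [this, h', sub_self]
        have h1 := congrArg Fin.val h0
        simp only [Fin.val_ofNat, Fin.val_zero] at h1
        rw [Nat.mod_eq_of_lt hi] at h1
        omega
  constructor
  · rintro ⟨r, hr⟩
    refine ⟨Fin.ofNat (n + 1) r - 1, (key _).1 ?_⟩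
    rw [sub_add_cancel, Fin.val_ofNat]
    have := List.rotate_mod (List.ofFn x) r
    rw [List.length_ofFn] at this
    rwa [this]
  · rintro ⟨r, hr⟩
    exact ⟨_, (key r).2 hr⟩

theorem readingWord_isRotated_ofFn_iff {M n : ℕ} (f : ℕ → ZMod M × Bool) {x : Fin (n + 1) → ℕ}
    (hx : Function.Injective x) :
    readingWord f (List.ofFn x).toFinset ~r List.ofFn x ↔
      ∃ r : Fin (n + 1), ∀ j ≠ r, blockKey f (x j) < blockKey f (x (j + 1)) := by
  have : IsTrans ℕ fun a b => blockKey f a < blockKey f b := ⟨fun _ _ _ => lt_trans⟩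
  rw [← exists_pairwise_rotate_ofFn_iff (R := fun a b => blockKey f a < blockKey f b)]
  constructor
  · intro h
    obtain ⟨r, hr⟩ := h.symm
    exact ⟨r, hr ▸ readingWord_pairwise f _⟩
  · rintro ⟨r, hr⟩
    rw [readingWord_eq f ?_ hr]
    · exact List.IsRotated.forall _ _
    · refine (List.rotate_perm _ _).trans ?_
      refine (List.perm_ext_iff_of_nodup (List.nodup_ofFn.2 hx) (Finset.nodup_toList _)).2 ?_
      simp

/-- The minimal increase of the block index forced from a letter `a` to the next letter `b`, whose
signs are `s` and `t`. -/
def forcedStep (a b : ℕ) (s t : Bool) : ℕ :=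
  if b < a then (if s then 1 else 0) else (if t then 0 else 1)

theorem forcedStep_le_one (a b : ℕ) (s t : Bool) : forcedStep a b s t ≤ 1 := by
  unfold forcedStep; split_ifs <;> simp

theorem blockKey_lt_iff {M : ℕ} (f : ℕ → ZMod M × Bool) {a b : ℕ} (h : a ≠ b) :
    blockKey f a < blockKey f b ↔
      (f a).1.val + forcedStep a b (f a).2 (f b).2 ≤ (f b).1.val := by
  simp only [blockKey, Prod.Lex.toLex_lt_toLex, forcedStep]
  rcases hs : (f a).2 <;> rcases ht : (f b).2 <;> simp <;> (try split_ifs) <;> omega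

theorem val_sub_sub_add {M : ℕ} [NeZero M] (a b : ZMod M) {e : ℕ} (he : e ≤ 1) :
    (b - a - e).val + a.val + e = b.val + if a.val + e ≤ b.val then 0 else M := by
  have ha := ZMod.val_lt a
  have hb := ZMod.val_lt b
  have h : (b - a - e : ZMod M) =
      ((b.val + (if a.val + e ≤ b.val then 0 else M) - a.val - e : ℕ) : ZMod M) := by
    rw [Nat.sub_sub, Nat.cast_sub (by split_ifs <;> omega)]
    split_ifs <;> push_cast <;> simp <;> ring
  rw [h, ZMod.val_cast_of_lt (by split_ifs <;> omega)]
  split_ifs <;> omega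

theorem exists_forall_ne_iff_sum_le {M n : ℕ} [NeZero M] (c : Fin (n + 1) → ZMod M)
    (e : Fin (n + 1) → ℕ) (he : ∀ j, e j ≤ 1) :
    (∃ r : Fin (n + 1), ∀ j ≠ r, (c j).val + e j ≤ (c (j + 1)).val) ↔
      ∑ j, (c (j + 1) - c j - e j).val + ∑ j, e j ≤ M := by
  set W := Finset.univ.filter fun j : Fin (n + 1) => ¬ (c j).val + e j ≤ (c (j + 1)).val with hW
  have hsum : ∑ j, (c (j + 1) - c j - e j).val + ∑ j, e j = W.card * M := by
    have h := Finset.sum_congr (rfl : (Finset.univ : Finset (Fin (n + 1))) = Finset.univ)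
      fun j _ => val_sub_sub_add (c j) (c (j + 1)) (he j)
    have hc : ∑ j, (c (j + 1)).val = ∑ j, (c j).val :=
      Equiv.sum_comp (Equiv.addRight (1 : Fin (n + 1))) fun j => (c j).val
    have hi : ∑ j, (if (c j).val + e j ≤ (c (j + 1)).val then 0 else M) = W.card * M := by
      rw [hW, Finset.card_filter, Finset.sum_mul]
      refine Finset.sum_congr rfl fun j _ => ?_
      split_ifs <;> simp
    rw [Finset.sum_add_distrib, Finset.sum_add_distrib, Finset.sum_add_distrib, hc, hi] at h
    omega
  have hM : 0 < M := Nat.pos_of_ne_zero (NeZero.ne M)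
  rw [hsum, show W.card * M ≤ M ↔ W.card ≤ 1 by
    constructor
    · intro h; by_contra! h'; nlinarith
    · intro h; nlinarith, Finset.card_le_one_iff_subset_singleton]
  refine exists_congr fun r => ?_
  constructor
  · intro h j hj
    by_contra h'
    simp only [hW, Finset.mem_filter, Finset.mem_univ, true_and] at hj
    exact hj (h j (by simpa using h'))
  · intro h j hj
    by_contra h'
    have := h (by simpa [hW] using h' : j ∈ W)
    exact hj (by simpa using this)

/-- The number of cyclic sequences of block indices that go round once with a total forced
increase `J`. -/
def windCount (n M J : ℕ) [NeZero M] : ℕ :=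
  (Finset.univ.filter fun c : Fin (n + 1) → ZMod M =>
    ∑ j, (c (j + 1) - c j - if j = 0 then (J : ZMod M) else 0).val + J ≤ M).card

theorem windCount_eq_zero {n M J : ℕ} [NeZero M] (h : M < J) : windCount n M J = 0 := by
  rw [windCount, Finset.card_eq_zero, Finset.filter_eq_empty_iff]
  intro c _
  omega

theorem windCount_self_ne_zero (n M : ℕ) [NeZero M] : windCount n M M ≠ 0 := by
  refine Finset.card_ne_zero_of_mem (a := 0) ?_
  simp

theorem exists_cyclic_sub_eq {G : Type*} [AddCommGroup G] {n : ℕ} (d : Fin (n + 1) → G)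
    (hd : ∑ j, d j = 0) : ∃ E : Fin (n + 1) → G, ∀ j, E (j + 1) - E j = d j := by
  set d' : ℕ → G := fun i => d (Fin.ofNat (n + 1) i) with hd'
  have hdj : ∀ j : Fin (n + 1), d' j.val = d j := fun j => by simp [hd']
  refine ⟨fun j => ∑ i ∈ Finset.range j.val, d' i, fun j => ?_⟩
  rw [← hdj j]
  rcases eq_or_ne j (Fin.last n) with rfl | hj
  · have : ∑ i ∈ Finset.range (n + 1), d' i = 0 := by
      rw [← Fin.sum_univ_eq_sum_range, ← hd]
      exact Finset.sum_congr rfl fun j _ => hdj j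
    rw [Finset.sum_range_succ] at this
    simp [eq_neg_of_add_eq_zero_left this]
  · beta_reduce
    rw [Fin.val_add_one, if_neg hj, Finset.sum_range_succ]
    abel

theorem card_sum_le_eq_windCount {n M : ℕ} [NeZero M] (e : Fin (n + 1) → ℕ) :
    (Finset.univ.filter fun c : Fin (n + 1) → ZMod M =>
      ∑ j, (c (j + 1) - c j - e j).val + ∑ j, e j ≤ M).card = windCount n M (∑ j, e j) := by
  obtain ⟨E, hE⟩ := exists_cyclic_sub_eq
    (fun j : Fin (n + 1) => (e j : ZMod M) - if j = 0 then ((∑ j, e j : ℕ) : ZMod M) else 0)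
    (by simp)
  refine Finset.card_equiv (Equiv.subRight E) fun c => ?_
  simp only [Finset.mem_filter, Finset.mem_univ, true_and, Equiv.subRight_apply, Pi.sub_apply]
  have : ∀ j, c (j + 1) - E (j + 1) - (c j - E j) -
      (if j = 0 then ((∑ j, e j : ℕ) : ZMod M) else 0) = c (j + 1) - c j - e j := by
    intro j
    linear_combination -hE j
  simp only [this]

end Winding

section Statistics

theorem labelSum_ofFn {M n : ℕ} [NeZero M] {x : Fin (n + 1) → ℕ} (hx : Function.Injective x) :
    labelSum M (List.ofFn x).toFinset (List.ofFn x) =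
      ∑ s : Fin (n + 1) → Bool, (∏ i, signWeight (s i)) *
        (windCount n M (∑ j, forcedStep (x j) (x (j + 1)) (s j) (s (j + 1))) : ℤ[X]) := by
  set A := (List.ofFn x).toFinset with hA
  have hmem : ∀ i, x i ∈ A := fun i => by
    rw [hA, List.mem_toFinset, List.mem_ofFn']
    exact ⟨i, rfl⟩
  let eA : Fin (n + 1) ≃ A := Equiv.ofBijective (fun i => ⟨x i, hmem i⟩)
    ⟨fun i j h => hx (congrArg Subtype.val h), by
      rintro ⟨a, ha⟩
      obtain ⟨i, hi⟩ : ∃ i, x i = a := by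
        rwa [hA, List.mem_toFinset, List.mem_ofFn'] at ha
      exact ⟨i, Subtype.ext hi⟩⟩
  let e : (Fin (n + 1) → Bool) × (Fin (n + 1) → ZMod M) ≃ (A → ZMod M × Bool) :=
    (Equiv.prodComm _ _).trans ((Equiv.arrowProdEquivProdArrow _ _ _).symm.trans
      (Equiv.arrowCongr eA (Equiv.refl _)))
  have he : ∀ s c i, e (s, c) (eA i) = (c i, s i) := by
    intro s c i
    simp [e]
  have hext : ∀ s c i, extendLabel (e (s, c)) (x i) = (c i, s i) := by
    intro s c i
    rw [extendLabel, dif_pos (hmem i)]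
    exact he s c i
  rw [labelSum, ← Fintype.sum_equiv e (fun p => if ∃ r : Fin (n + 1), ∀ j ≠ r,
      (p.2 j).val + forcedStep (x j) (x (j + 1)) (p.1 j) (p.1 (j + 1)) ≤ (p.2 (j + 1)).val
      then ∏ i, signWeight (p.1 i) else 0), Fintype.sum_prod_type]
  · refine Finset.sum_congr rfl fun s _ => ?_
    rw [← card_sum_le_eq_windCount, Finset.card_filter, Nat.cast_sum, Finset.mul_sum]
    refine Finset.sum_congr rfl fun c _ => ?_
    simp only [exists_forall_ne_iff_sum_le c _ fun j => forcedStep_le_one _ _ _ _]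
    split_ifs <;> simp
  · rintro ⟨s, c⟩
    have h1 : (readingWord (extendLabel (e (s, c))) A : Cycle ℕ) = (List.ofFn x : Cycle ℕ) ↔
        ∃ r : Fin (n + 1), ∀ j ≠ r,
          (c j).val + forcedStep (x j) (x (j + 1)) (s j) (s (j + 1)) ≤ (c (j + 1)).val := by
      rw [Cycle.coe_eq_coe, readingWord_isRotated_ofFn_iff _ hx]
      refine exists_congr fun r => forall₂_congr fun j hj => ?_
      have hne : x j ≠ x (j + 1) := by
        intro h
        have h' : (1 : Fin (n + 1)) = 0 := by simpa using (hx h).symm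
        exact hj (by
          have : n = 0 := by
            by_contra hn
            obtain ⟨m, rfl⟩ := Nat.exists_eq_succ_of_ne_zero hn
            simp at h'
          subst this
          exact (Fin.subsingleton_one).elim _ _)
      rw [blockKey_lt_iff _ hne]
      simp only [hext]
    simp only [h1]
    have h2 : ∏ i, signWeight (s i) = ∏ a, signWeight (e (s, c) a).2 := by
      rw [← Equiv.prod_comp eA]
      simp only [he]
    rw [h2]

/-- The generating polynomial of sign sequences by forced increase (`X`) and number of negative
signs (`C X`), for cyclic permutations of length `N` with `k` peaks and `d` descents. -/
noncomputable def statPoly (N k d : ℕ) : ℤ[X][X] :=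
  (1 + X * C X) ^ (N - d - k) * (X + C X) ^ (d - k) * (X ^ k * (1 + C X) ^ (2 * k))

/-- The common value of `labelSum` on cyclic permutations of length `n + 1` with `k` peaks and `d`
descents. -/
noncomputable def labelPoly (n M k d : ℕ) [NeZero M] : ℤ[X] :=
  ∑ J ∈ Finset.range (M + 1), (statPoly (n + 1) k d).coeff J * (windCount n M J : ℤ[X])

theorem sum_mul_windCount_eq {ι : Type*} [Fintype ι] (n M : ℕ) [NeZero M] (a : ι → ℤ[X])
    (J : ι → ℕ) :
    ∑ s, a s * (windCount n M (J s) : ℤ[X]) =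
      ∑ i ∈ Finset.range (M + 1), (∑ s, C (a s) * X ^ J s : ℤ[X][X]).coeff i *
        (windCount n M i : ℤ[X]) := by
  simp only [finsetSum_coeff, coeff_C_mul, coeff_X_pow, Finset.sum_mul]
  rw [Finset.sum_comm]
  refine Finset.sum_congr rfl fun s _ => ?_
  simp only [mul_ite, mul_one, mul_zero, ite_mul, zero_mul]
  rw [Finset.sum_ite_eq']
  split_ifs with h
  · rfl
  · rw [windCount_eq_zero (by simpa using h)]
    simp

section Cyclic

variable {n : ℕ} (x : Fin (n + 1) → ℕ)

theorem sum_signs_eq_prod :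
    (∑ s : Fin (n + 1) → Bool, C (∏ i, signWeight (s i)) *
      X ^ (∑ j, forcedStep (x j) (x (j + 1)) (s j) (s (j + 1))) : ℤ[X][X]) =
      ∏ i, (if x (i + 1) < x i then (if x i < x (i - 1) then X + C X else X * (1 + C X))
        else (if x i < x (i - 1) then 1 + C X else 1 + X * C X) : ℤ[X][X]) := by
  have hstep : ∀ s : Fin (n + 1) → Bool,
      ∑ j, forcedStep (x j) (x (j + 1)) (s j) (s (j + 1)) =
        ∑ j, ((if x (j + 1) < x j then (if s j then 1 else 0) else 0) +
          (if x j < x (j - 1) then 0 else (if s j then 0 else 1))) := by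
    intro s
    rw [Finset.sum_add_distrib, ← Equiv.sum_comp (Equiv.addRight (1 : Fin (n + 1)))
      fun j => (if x j < x (j - 1) then 0 else (if s j then 0 else 1) : ℕ), ← Finset.sum_add_distrib]
    refine Finset.sum_congr rfl fun j _ => ?_
    simp only [forcedStep, Equiv.coe_addRight, add_sub_cancel_right]
    split_ifs <;> simp_all
  have hloc : ∀ i, (if x (i + 1) < x i then
        (if x i < x (i - 1) then X + C X else X * (1 + C X))
        else (if x i < x (i - 1) then 1 + C X else 1 + X * C X) : ℤ[X][X]) =
      ∑ b ∈ (Finset.univ : Finset Bool), C (signWeight b) *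
        X ^ ((if x (i + 1) < x i then (if b then 1 else 0) else 0) +
          (if x i < x (i - 1) then 0 else (if b then 0 else 1))) := by
    intro i
    split_ifs <;> simp [signWeight]
    ring
  simp only [hloc]
  rw [Finset.prod_univ_sum, Fintype.piFinset_univ]
  refine Finset.sum_congr rfl fun s _ => ?_
  rw [Finset.prod_mul_distrib, hstep, Finset.prod_pow_eq_pow_sum, map_prod]

/-- Number of cyclic descents of a sequence. -/
def seqDes : ℕ := (Finset.univ.filter fun i => x (i + 1) < x i).card

/-- Number of cyclic peaks of a sequence. -/
def seqPk : ℕ := (Finset.univ.filter fun i => x (i + 1) < x i ∧ ¬ x i < x (i - 1)).card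

theorem seqDes_eq_add : seqDes x = seqPk x +
    (Finset.univ.filter fun i => x (i + 1) < x i ∧ x i < x (i - 1)).card := by
  rw [seqDes, seqPk, ← Finset.card_filter_add_card_filter_not fun i => x i < x (i - 1),
    Finset.filter_filter, Finset.filter_filter, add_comm]

theorem seqDes_eq_add' :
    seqDes x = (Finset.univ.filter fun i => ¬ x (i + 1) < x i ∧ x i < x (i - 1)).card +
      (Finset.univ.filter fun i => x (i + 1) < x i ∧ x i < x (i - 1)).card := by
  have : seqDes x = (Finset.univ.filter fun i => x i < x (i - 1)).card := by
    refine Finset.card_equiv (Equiv.addRight (1 : Fin (n + 1))) fun i => ?_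
    simp
  rw [this, ← Finset.card_filter_add_card_filter_not fun i => x (i + 1) < x i,
    Finset.filter_filter, Finset.filter_filter, add_comm]
  simp only [and_comm]

theorem seq_card_eq : n + 1 = seqDes x + seqPk x +
    (Finset.univ.filter fun i => ¬ x (i + 1) < x i ∧ ¬ x i < x (i - 1)).card := by
  have h1 := seqDes_eq_add x
  have h2 := seqDes_eq_add' x
  have h3 : (Finset.univ : Finset (Fin (n + 1))).card = n + 1 := by simp
  rw [← Finset.card_filter_add_card_filter_not fun i => x (i + 1) < x i] at h3
  have h4 := Finset.card_filter_add_card_filter_not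
    (s := Finset.univ.filter fun i => ¬ x (i + 1) < x i) fun i => x i < x (i - 1)
  rw [Finset.filter_filter, Finset.filter_filter] at h4
  have h5 : seqDes x = (Finset.univ.filter fun i => x (i + 1) < x i).card := rfl
  omega

theorem prod_local_eq_statPoly :
    ∏ i, (if x (i + 1) < x i then (if x i < x (i - 1) then X + C X else X * (1 + C X))
        else (if x i < x (i - 1) then 1 + C X else 1 + X * C X) : ℤ[X][X]) =
      statPoly (n + 1) (seqPk x) (seqDes x) := by
  have h1 := seqDes_eq_add x
  have h2 := seqDes_eq_add' x
  have h3 := seq_card_eq x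
  simp only [Finset.prod_ite, Finset.prod_const, Finset.filter_filter]
  have h4 : (Finset.univ.filter fun i => x (i + 1) < x i ∧ ¬ x i < x (i - 1)).card = seqPk x := rfl
  rw [h4, statPoly, mul_pow,
    show (Finset.univ.filter fun i => x (i + 1) < x i ∧ x i < x (i - 1)).card =
      seqDes x - seqPk x by omega,
    show (Finset.univ.filter fun i => ¬ x (i + 1) < x i ∧ x i < x (i - 1)).card = seqPk x by omega,
    show (Finset.univ.filter fun i => ¬ x (i + 1) < x i ∧ ¬ x i < x (i - 1)).card =
      n + 1 - seqDes x - seqPk x by omega]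
  ring

theorem labelSum_ofFn_eq_labelPoly (M : ℕ) [NeZero M] {x : Fin (n + 1) → ℕ}
    (hx : Function.Injective x) :
    labelSum M (List.ofFn x).toFinset (List.ofFn x) = labelPoly n M (seqPk x) (seqDes x) := by
  rw [labelSum_ofFn hx, sum_mul_windCount_eq, sum_signs_eq_prod, prod_local_eq_statPoly, labelPoly]

theorem seqPk_le_seqDes : seqPk x ≤ seqDes x := by
  have := seqDes_eq_add x
  omega

theorem seqPk_pos {x : Fin (n + 1) → ℕ} (hx : Function.Injective x) (hn : n ≠ 0) :
    0 < seqPk x := by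
  obtain ⟨i, hi⟩ := Finite.exists_max x
  refine Finset.card_pos.2 ⟨i, ?_⟩
  have hne : i + 1 ≠ i := by
    obtain ⟨m, rfl⟩ := Nat.exists_eq_succ_of_ne_zero hn
    simp
  simp only [Finset.mem_filter, Finset.mem_univ, true_and]
  exact ⟨lt_of_le_of_ne (hi _) fun h => hne (hx h), (hi _).not_gt⟩

theorem getD_ofFn_mod (m : ℕ) :
    (List.ofFn x).getD (m % (n + 1)) 0 = x (Fin.ofNat (n + 1) m) := by
  rw [List.getD_eq_getElem _ _ (by simpa using Nat.mod_lt _ (Nat.succ_pos n)), List.getElem_ofFn]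
  rfl

theorem getD_ofFn_val (i : Fin (n + 1)) : (List.ofFn x).getD i.val 0 = x i := by
  rw [List.getD_eq_getElem _ _ (by rw [List.length_ofFn]; exact i.isLt), List.getElem_ofFn]

theorem image_succ_univ :
    Finset.univ.image (fun i : Fin (n + 1) => i.val + 1) = Finset.Icc 1 (n + 1) := by
  ext j
  simp only [Finset.mem_image, Finset.mem_univ, true_and, Finset.mem_Icc]
  constructor
  · rintro ⟨i, rfl⟩
    omega
  · rintro ⟨h1, h2⟩
    exact ⟨⟨j - 1, by omega⟩, by simp; omega⟩

theorem card_filter_Icc (p : ℕ → Prop) [DecidablePred p] :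
    ((Finset.Icc 1 (n + 1)).filter p).card =
      (Finset.univ.filter fun i : Fin (n + 1) => p (i.val + 1)).card := by
  rw [← image_succ_univ, Finset.filter_image, Finset.card_image_of_injective]
  intro i j h
  exact Fin.ext (by simpa using h)

theorem ofNat_val_add_one (i : Fin (n + 1)) : Fin.ofNat (n + 1) (i.val + 1) = i + 1 := by
  ext; simp [Fin.val_add]

theorem ofNat_val_add (i : Fin (n + 1)) : Fin.ofNat (n + 1) (i.val + n) = i - 1 := by
  rw [eq_sub_iff_add_eq]
  ext
  simp [Fin.val_add, add_assoc, Nat.lt_succ_iff.1 i.isLt]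

theorem cdes_ofFn : cdes (List.ofFn x) = seqDes x := by
  rw [cdes, cDes, List.length_ofFn, card_filter_Icc, seqDes]
  simp only [getD_ofFn_mod, add_tsub_cancel_right, getD_ofFn_val, ofNat_val_add_one]

theorem cpk_ofFn {x : Fin (n + 1) → ℕ} (hx : Function.Injective x) :
    cpk (List.ofFn x) = seqPk x := by
  rw [cpk, cPk, List.length_ofFn, card_filter_Icc, seqPk]
  congr 1
  refine Finset.filter_congr fun i _ => ?_
  rw [show i.val + 1 + (n + 1) - 2 = i.val + n by omega]
  simp only [getD_ofFn_mod, add_tsub_cancel_right, getD_ofFn_val, ofNat_val_add_one,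
    ofNat_val_add]
  rw [and_comm]
  refine and_congr_right fun h => ⟨fun h' => h'.not_gt, fun h' => ?_⟩
  refine lt_of_le_of_ne (not_lt.1 h') fun heq => ?_
  have h0 := hx heq
  have : i + 1 = i := by
    conv_lhs => rw [← h0]
    exact sub_add_cancel _ _
  rw [this] at h
  exact lt_irrefl _ h

end Cyclic

variable {π : List ℕ}

theorem exists_eq_ofFn (hπ : π.Nodup) (h : π ≠ []) :
    ∃ (n : ℕ) (x : Fin (n + 1) → ℕ), Function.Injective x ∧ π = List.ofFn x := by
  obtain ⟨a, l, rfl⟩ := List.exists_cons_of_ne_nil h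
  exact ⟨l.length, (a :: l).get, List.nodup_iff_injective_get.1 hπ, (List.ofFn_get _).symm⟩

theorem labelSum_eq_labelPoly (M : ℕ) [NeZero M] (hπ : π.Nodup) (h : π ≠ []) :
    labelSum M π.toFinset π = labelPoly (π.length - 1) M (cpk π) (cdes π) := by
  obtain ⟨n, x, hx, rfl⟩ := exists_eq_ofFn hπ h
  rw [cpk_ofFn hx, cdes_ofFn, labelSum_ofFn_eq_labelPoly M hx, List.length_ofFn,
    add_tsub_cancel_right]

theorem cpk_le_cdes (hπ : π.Nodup) (h : π ≠ []) : cpk π ≤ cdes π := by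
  obtain ⟨n, x, hx, rfl⟩ := exists_eq_ofFn hπ h
  rw [cpk_ofFn hx, cdes_ofFn]
  exact seqPk_le_seqDes x

theorem cpk_pos (hπ : π.Nodup) (h : 2 ≤ π.length) : 0 < cpk π := by
  obtain ⟨n, x, hx, rfl⟩ := exists_eq_ofFn hπ (by rintro rfl; simp at h)
  rw [cpk_ofFn hx]
  rw [List.length_ofFn] at h
  exact seqPk_pos hx (by omega)

end Statistics

section Independence

theorem coeff_statPoly (N k d J : ℕ) (h : J < k) : (statPoly N k d).coeff J = 0 := by
  rw [statPoly, show ∀ a b : ℤ[X][X], a * (X ^ k * b) = X ^ k * (a * b) by intros; ring,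
    coeff_X_pow_mul', if_neg (by omega)]

theorem coeff_statPoly_self (N k d : ℕ) :
    (statPoly N k d).coeff k = X ^ (d - k) * (1 + X) ^ (2 * k) := by
  rw [statPoly, show ∀ a b : ℤ[X][X], a * (X ^ k * b) = X ^ k * (a * b) by intros; ring,
    coeff_X_pow_mul', if_pos le_rfl, Nat.sub_self, coeff_zero_eq_eval_zero]
  simp

theorem labelPoly_eq_zero {n M k : ℕ} [NeZero M] (d : ℕ) (h : M < k) : labelPoly n M k d = 0 := by
  refine Finset.sum_eq_zero fun J hJ => ?_
  rw [Finset.mem_range] at hJ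
  rw [coeff_statPoly _ _ _ _ (by omega), zero_mul]

theorem labelPoly_self (n k d : ℕ) [NeZero k] :
    labelPoly n k k d = X ^ (d - k) * ((1 + X) ^ (2 * k) * (windCount n k k : ℤ[X])) := by
  rw [labelPoly, Finset.sum_range_succ, Finset.sum_eq_zero, coeff_statPoly_self, zero_add, mul_assoc]
  intro J hJ
  rw [coeff_statPoly _ _ _ _ (Finset.mem_range.1 hJ), zero_mul]

/-- A family of peak and descent numbers is determined by its total `labelPoly`. -/
theorem eq_of_sum_labelPoly_eq (n : ℕ) {m m' : Multiset (ℕ × ℕ)}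
    (hm : ∀ v ∈ m, 0 < v.1 ∧ v.1 ≤ v.2) (hm' : ∀ v ∈ m', 0 < v.1 ∧ v.1 ≤ v.2)
    (h : ∀ (M : ℕ) [NeZero M], (m.map fun v => labelPoly n M v.1 v.2).sum =
      (m'.map fun v => labelPoly n M v.1 v.2).sum) : m = m' := by
  set T := m.toFinset ∪ m'.toFinset with hT
  have hTv : ∀ v ∈ T, 0 < v.1 ∧ v.1 ≤ v.2 := by
    intro v hv
    rw [hT, Finset.mem_union, Multiset.mem_toFinset, Multiset.mem_toFinset] at hv
    exact hv.elim (hm v) (hm' v)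
  let δ : ℕ × ℕ → ℤ := fun v => (m.count v : ℤ) - m'.count v
  have hδ : ∀ v ∉ T, δ v = 0 := by
    intro v hv
    simp only [hT, Finset.mem_union, Multiset.mem_toFinset, not_or] at hv
    simp [δ, hv.1, hv.2]
  have hsum : ∀ (M : ℕ) [NeZero M], ∑ v ∈ T, C (δ v) * labelPoly n M v.1 v.2 = 0 := by
    intro M _
    have hcount : ∀ s : Multiset (ℕ × ℕ), s.toFinset ⊆ T →
        (s.map fun v => labelPoly n M v.1 v.2).sum =
          ∑ v ∈ T, C (s.count v : ℤ) * labelPoly n M v.1 v.2 := by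
      intro s hs
      rw [Finset.sum_multiset_map_count]
      refine (Finset.sum_subset hs fun v _ hv => ?_).trans
        (Finset.sum_congr rfl fun v _ => ?_)
      · rw [Multiset.count_eq_zero.2 (by simpa using hv), zero_smul]
      · simp
    have := h M
    rw [hcount m Finset.subset_union_left, hcount m' Finset.subset_union_right] at this
    simp only [δ, C_sub, sub_mul, Finset.sum_sub_distrib]
    rw [this, sub_self]
  have hzero : ∀ k d, δ (k, d) = 0 := by
    intro k
    induction k using Nat.strong_induction_on with
    | _ k ih =>
      intro d
      by_cases hk : (k, d) ∈ T
      swap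
      · exact hδ _ hk
      obtain ⟨hk0, hkd⟩ := hTv _ hk
      have : NeZero k := ⟨hk0.ne'⟩
      have h1 := hsum k
      have h2 : ∀ v ∈ T, C (δ v) * labelPoly n k v.1 v.2 =
          (if v.1 = k then C (δ v) * X ^ (v.2 - k) else 0) *
            ((1 + X) ^ (2 * k) * (windCount n k k : ℤ[X])) := by
        rintro ⟨i, j⟩ _
        rcases lt_trichotomy i k with hi | rfl | hi
        · simp [ih i hi j, hi.ne]
        · simp [labelPoly_self, mul_assoc]
        · simp [labelPoly_eq_zero _ hi, hi.ne']
      rw [Finset.sum_congr rfl h2, ← Finset.sum_mul] at h1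
      have hne : ((1 + X) ^ (2 * k) * (windCount n k k : ℤ[X])) ≠ 0 := by
        refine mul_ne_zero (pow_ne_zero _ ?_) (by exact_mod_cast windCount_self_ne_zero n k)
        rw [add_comm]
        exact (monic_X_add_C (1 : ℤ)).ne_zero
      have h3 := congrArg (fun p => coeff p (d - k)) ((mul_eq_zero.1 h1).resolve_right hne)
      simp only [finsetSum_coeff, coeff_zero] at h3
      rw [Finset.sum_eq_single (k, d)] at h3
      · simpa using h3
      · rintro ⟨i, j⟩ hv hv'
        split_ifs with hi
        · simp only at hi
          subst hi
          have hij := (hTv _ hv).2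
          simp only at hij hkd
          have : ¬ d - i = j - i := fun h' => hv' (by
            rw [show j = d by omega])
          simp [coeff_X_pow, this]
        · simp
      · exact fun h' => absurd hk h'
  ext v
  have := hzero v.1 v.2
  simp only [δ, Prod.mk.eta, sub_eq_zero] at this
  exact_mod_cast this

end Independence

section Main

variable {π σ τ : List ℕ}

theorem labelSum_coe_of_isCyclicShuffle (M : ℕ) [NeZero M] (hπ : π.Nodup) (hσ : σ.Nodup)
    (hd : π.Disjoint σ) (hN : 2 ≤ π.length + σ.length) (h : IsCyclicShuffle π σ τ) :
    labelSum M (π.toFinset ∪ σ.toFinset) τ =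
        labelPoly (π.length + σ.length - 1) M (cpk τ) (cdes τ) ∧
      0 < cpk τ ∧ cpk τ ≤ cdes τ := by
  have hp := ((isCyclicShuffle_iff hπ hσ hd).1 h).1
  have hτ : τ.Nodup := hp.nodup_iff.2 (hπ.append hσ hd)
  have hl : τ.length = π.length + σ.length := by rw [hp.length_eq, List.length_append]
  have hne : τ ≠ [] := by rintro rfl; simp at hl; omega
  rw [← List.toFinset_append, ← List.toFinset_eq_of_perm _ _ hp, ← hl]
  exact ⟨labelSum_eq_labelPoly M hτ hne, cpk_pos hτ (by omega), cpk_le_cdes hτ hne⟩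

/-- The statistic `(cpk, cdes)` on cyclic permutations. -/
noncomputable def cyclePkDes (c : Cycle ℕ) : ℕ × ℕ := (cpk (Quotient.out c), cdes (Quotient.out c))

theorem cyclePkDes_coe (hπ : π.Nodup) (hσ : σ.Nodup) (hd : π.Disjoint σ)
    (hN : 2 ≤ π.length + σ.length) (h : IsCyclicShuffle π σ τ) :
    cyclePkDes (τ : Cycle ℕ) = (cpk τ, cdes τ) := by
  have e : ((Quotient.out (τ : Cycle ℕ) : List ℕ) : Cycle ℕ) = (τ : Cycle ℕ) := Quotient.out_eq _
  have h' : IsCyclicShuffle π σ (Quotient.out (τ : Cycle ℕ)) :=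
    isCyclicShuffle_of_isRotated hπ hσ hd (Cycle.coe_eq_coe.1 e).symm h
  have key := eq_of_sum_labelPoly_eq (π.length + σ.length - 1)
    (m := {cyclePkDes (τ : Cycle ℕ)}) (m' := {(cpk τ, cdes τ)}) ?_ ?_ ?_
  · simpa using key
  · have := (labelSum_coe_of_isCyclicShuffle 1 hπ hσ hd hN h').2
    simpa [cyclePkDes] using this
  · have := (labelSum_coe_of_isCyclicShuffle 1 hπ hσ hd hN h).2
    simpa using this
  · intro M _
    simp only [Multiset.map_singleton, Multiset.sum_singleton, cyclePkDes]
    rw [← (labelSum_coe_of_isCyclicShuffle M hπ hσ hd hN h').1,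
      ← (labelSum_coe_of_isCyclicShuffle M hπ hσ hd hN h).1, e]

theorem ncard_cycShuffleFiber_eq_count (hπ : π.Nodup) (hσ : σ.Nodup) (hd : π.Disjoint σ)
    (hN : 2 ≤ π.length + σ.length) (v : ℕ × ℕ) :
    (cycShuffleFiber (fun π => (cpk π, cdes π)) π σ v).ncard =
      ((cycShuffles π σ).val.map cyclePkDes).count v := by
  have : cycShuffleFiber (fun π => (cpk π, cdes π)) π σ v =
      ↑((cycShuffles π σ).filter fun c => v = cyclePkDes c) := by
    ext c
    simp only [cycShuffleFiber, Set.mem_ofPred_eq, Finset.coe_filter]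
    constructor
    · rintro ⟨τ, rfl, h, rfl⟩
      exact ⟨(coe_mem_cycShuffles hπ hσ hd).2 h, (cyclePkDes_coe hπ hσ hd hN h).symm⟩
    · induction c using Quotient.inductionOn with
      | _ τ =>
        rintro ⟨h, rfl⟩
        have hs := (coe_mem_cycShuffles hπ hσ hd).1 h
        exact ⟨τ, rfl, hs, (cyclePkDes_coe hπ hσ hd hN hs).symm⟩
  rw [this, Set.ncard_coe_finset, Multiset.count_map]
  rfl

theorem sum_labelPoly_cycShuffles (hπ : π.Nodup) (hσ : σ.Nodup) (hd : π.Disjoint σ)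
    (hN : 2 ≤ π.length + σ.length) (M : ℕ) [NeZero M] :
    (((cycShuffles π σ).val.map cyclePkDes).map
        fun v => labelPoly (π.length + σ.length - 1) M v.1 v.2).sum =
      labelSum M π.toFinset π * labelSum M σ.toFinset σ := by
  rw [← sum_labelSum_cycShuffles hπ hσ hd, Multiset.map_map]
  refine Finset.sum_congr rfl fun c => ?_
  induction c using Quotient.inductionOn with
  | _ τ =>
    intro h
    have hs := (coe_mem_cycShuffles hπ hσ hd).1 h
    have hv := cyclePkDes_coe hπ hσ hd hN hs
    change labelPoly _ M (cyclePkDes (τ : Cycle ℕ)).1 (cyclePkDes (τ : Cycle ℕ)).2 = _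
    rw [hv]
    exact (labelSum_coe_of_isCyclicShuffle M hπ hσ hd hN hs).1.symm

theorem cyclePkDes_bounds (hπ : π.Nodup) (hσ : σ.Nodup) (hd : π.Disjoint σ)
    (hN : 2 ≤ π.length + σ.length) :
    ∀ v ∈ (cycShuffles π σ).val.map cyclePkDes, 0 < v.1 ∧ v.1 ≤ v.2 := by
  intro v hv
  obtain ⟨c, hc, rfl⟩ := Multiset.mem_map.1 hv
  induction c using Quotient.inductionOn with
  | _ τ =>
    have hs := (coe_mem_cycShuffles hπ hσ hd).1 hc
    have h := (labelSum_coe_of_isCyclicShuffle 1 hπ hσ hd hN hs).2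
    have e := cyclePkDes_coe hπ hσ hd hN hs
    exact e ▸ h

theorem labelSum_congr (M : ℕ) [NeZero M] {π' : List ℕ} (hπ : π.Nodup) (hπ' : π'.Nodup)
    (hl : π.length = π'.length) (h : (cpk π, cdes π) = (cpk π', cdes π')) :
    labelSum M π.toFinset π = labelSum M π'.toFinset π' := by
  rw [Prod.mk.injEq] at h
  rcases eq_or_ne π [] with rfl | hne
  · rw [List.eq_nil_of_length_eq_zero hl.symm]
  · have hne' : π' ≠ [] := by
      rintro rfl
      exact hne (List.eq_nil_of_length_eq_zero hl)
    rw [labelSum_eq_labelPoly M hπ hne, labelSum_eq_labelPoly M hπ' hne', hl, h.1, h.2]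

theorem cycShuffleFiber_of_length_add_le_one {A : Type*} {cst : List ℕ → A} (hπ : π.Nodup)
    (hσ : σ.Nodup) (hd : π.Disjoint σ) (hN : π.length + σ.length ≤ 1) (v : A) :
    cycShuffleFiber cst π σ v = {c | c = ((π ++ σ : List ℕ) : Cycle ℕ) ∧ cst (π ++ σ) = v} := by
  have hl : (π ++ σ).length ≤ 1 := by simpa using hN
  have key : ∀ τ, IsCyclicShuffle π σ τ ↔ τ = π ++ σ := by
    intro τ
    rw [isCyclicShuffle_iff hπ hσ hd]
    constructor
    · rintro ⟨h, -⟩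
      rcases Nat.le_one_iff_eq_zero_or_eq_one.1 hl with h0 | h0
      · rw [List.length_eq_zero_iff] at h0
        rw [h0] at h ⊢
        exact h.eq_nil
      · obtain ⟨a, ha⟩ := List.length_eq_one_iff.1 h0
        rw [ha] at h ⊢
        exact List.perm_singleton.1 h
    · rintro rfl
      obtain ⟨h1, h2⟩ := filter_mem_of_perm_append hd (List.Perm.refl (π ++ σ))
      refine ⟨List.Perm.refl _, ?_, ?_⟩
      · have : (π ++ σ).filter (· ∈ π.toFinset) = π := by
          rcases Nat.eq_zero_or_pos π.length with h0 | h0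
          · rw [List.length_eq_zero_iff] at h0
            rw [h0] at h1 ⊢
            exact h1.eq_nil
          · obtain ⟨a, ha⟩ := List.length_eq_one_iff.1 (show π.length = 1 by omega)
            rw [ha] at h1 ⊢
            exact List.perm_singleton.1 h1
        rw [this]
      · have : (π ++ σ).filter (· ∈ σ.toFinset) = σ := by
          rcases Nat.eq_zero_or_pos σ.length with h0 | h0
          · rw [List.length_eq_zero_iff] at h0
            rw [h0] at h2 ⊢
            exact h2.eq_nil
          · obtain ⟨a, ha⟩ := List.length_eq_one_iff.1 (show σ.length = 1 by omega)
            rw [ha] at h2 ⊢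
            exact List.perm_singleton.1 h2
        rw [this]
  ext c
  simp only [cycShuffleFiber, key, Set.mem_ofPred_eq]
  constructor
  · rintro ⟨τ, rfl, rfl, rfl⟩
    exact ⟨rfl, rfl⟩
  · rintro ⟨rfl, rfl⟩
    exact ⟨_, rfl, rfl, rfl⟩

theorem cpk_cdes_of_length_le_one {l : List ℕ} (h : l.length ≤ 1) : (cpk l, cdes l) = (0, 0) := by
  rcases Nat.le_one_iff_eq_zero_or_eq_one.1 h with h0 | h0
  · rw [List.length_eq_zero_iff] at h0
    subst h0
    rfl
  · obtain ⟨a, rfl⟩ := List.length_eq_one_iff.1 h0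
    simp [cpk, cPk, cdes, cDes]

theorem ncard_cycShuffleFiber_of_length_add_le_one (hπ : π.Nodup) (hσ : σ.Nodup)
    (hd : π.Disjoint σ) (hN : π.length + σ.length ≤ 1) (v : ℕ × ℕ) :
    (cycShuffleFiber (fun π => (cpk π, cdes π)) π σ v).ncard = if (0, 0) = v then 1 else 0 := by
  rw [cycShuffleFiber_of_length_add_le_one hπ hσ hd hN]
  rw [cpk_cdes_of_length_le_one (by simpa using hN)]
  split_ifs with h <;> simp [h]

end Main

/-- The pair `(cpk, cdes)` is cyclic shuffle-compatible. -/
theorem cpk_cdes_cyclic_shuffle_compatible :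
    CyclicShuffleCompatible (fun π => (cpk π, cdes π)) := by
  intro π σ π' σ' hπ hσ hπ' hσ' hd hd' hl hl' hst hst' v
  rcases Nat.lt_or_ge 1 (π.length + σ.length) with hN | hN
  · have hN' : 2 ≤ π'.length + σ'.length := by omega
    rw [ncard_cycShuffleFiber_eq_count hπ.1 hσ.1 hd hN,
      ncard_cycShuffleFiber_eq_count hπ'.1 hσ'.1 hd' hN']
    congr 1
    refine eq_of_sum_labelPoly_eq (π.length + σ.length - 1) (cyclePkDes_bounds hπ.1 hσ.1 hd hN)
      (cyclePkDes_bounds hπ'.1 hσ'.1 hd' hN') fun M _ => ?_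
    rw [sum_labelPoly_cycShuffles hπ.1 hσ.1 hd hN, hl, hl',
      sum_labelPoly_cycShuffles hπ'.1 hσ'.1 hd' hN', labelSum_congr M hπ.1 hπ'.1 hl hst,
      labelSum_congr M hσ.1 hσ'.1 hl' hst']
  · rw [ncard_cycShuffleFiber_of_length_add_le_one hπ.1 hσ.1 hd hN,
      ncard_cycShuffleFiber_of_length_add_le_one hπ'.1 hσ'.1 hd' (by omega)]
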